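/- Let μ be the pre-Lie multiplication on ℂ² given by e1·e1 = e1, e2·e2 = e2 (algebra C07), and let ν be any bilinear map on ℂ² such that (ℂ², μ, ν) is a compatible pre-Lie algebra. Then (ℂ², μ, ν) is isomorphic as a compatible pre-Lie algebra to one of: C38^{α,β,γ} (α,β,γ ∈ ℂ) with first multiplication μ and second multiplication e1∗e1 = (γ + β − α) e1 − β e2, e1∗e2 = α e1 + β e2, e2∗e1 = α e1 + β e2, e2∗e2 = −α e1 + γ e2; or C39^{α,β} (α,β ∈ ℂ, β ≠ α) with first multiplication μ and second multiplication e1∗e1 = α e1, e2∗e2 = β e2. -/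

import Mathlib

open scoped BigOperators

/-- The underlying vector space `ℂ²`. -/
abbrev V2 : Type := Fin 2 → ℂ

/-- The first standard basis vector of `ℂ²`. -/
noncomputable def e1 : V2 := ![1, 0]

/-- The second standard basis vector of `ℂ²`. -/
noncomputable def e2 : V2 := ![0, 1]

/-- The bilinear multiplication on `ℂ²` with multiplication table `f`,
i.e. the product of the `i`-th and `j`-th basis vectors is `f i j`. -/
noncomputable def bil (f : Fin 2 → Fin 2 → V2) : V2 →ₗ[ℂ] V2 →ₗ[ℂ] V2 :=
  LinearMap.mk₂ ℂ (fun x y => ∑ i : Fin 2, ∑ j : Fin 2, (x i * y j) • f i j)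
    (fun x x' y => by
      simp only [Pi.add_apply, add_mul, add_smul, Finset.sum_add_distrib])
    (fun c x y => by
      simp only [Pi.smul_apply, smul_eq_mul, Finset.smul_sum, smul_smul]
      refine Finset.sum_congr rfl fun i _ => Finset.sum_congr rfl fun j _ => ?_
      congr 1
      ring)
    (fun x y y' => by
      simp only [Pi.add_apply, mul_add, add_smul, Finset.sum_add_distrib])
    (fun c x y => by
      simp only [Pi.smul_apply, smul_eq_mul, Finset.smul_sum, smul_smul]
      refine Finset.sum_congr rfl fun i _ => Finset.sum_congr rfl fun j _ => ?_
      congr 1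
      ring)

/-- A bilinear map is a pre-Lie multiplication if it satisfies the (right)
pre-Lie identity. -/
def IsPreLie {V : Type*} [AddCommGroup V] [Module ℂ V]
    (μ : V →ₗ[ℂ] V →ₗ[ℂ] V) : Prop :=
  ∀ x y z : V, μ (μ x y) z - μ x (μ y z) = μ (μ y x) z - μ y (μ x z)

/-- `(V, μ, ν)` is a compatible pre-Lie algebra: `μ`, `ν` and `μ + ν` are all
pre-Lie multiplications. -/
def IsCompatPreLie {V : Type*} [AddCommGroup V] [Module ℂ V]
    (μ ν : V →ₗ[ℂ] V →ₗ[ℂ] V) : Prop :=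
  IsPreLie μ ∧ IsPreLie ν ∧ IsPreLie (μ + ν)

/-- Isomorphism of the two-multiplication algebras `(ℂ², μ, ν)` and `(ℂ², μ', ν')`. -/
def CompatIso (μ ν μ' ν' : V2 →ₗ[ℂ] V2 →ₗ[ℂ] V2) : Prop :=
  ∃ φ : V2 ≃ₗ[ℂ] V2, (∀ x y : V2, φ (μ x y) = μ' (φ x) (φ y)) ∧
    (∀ x y : V2, φ (ν x y) = ν' (φ x) (φ y))

/-- `C01 : e1·e1 = e1 + e2, e2·e1 = e2`. -/
noncomputable def C01 : V2 →ₗ[ℂ] V2 →ₗ[ℂ] V2 := bil ![![e1 + e2, 0], ![e2, 0]]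

/-- `C02 : e1·e1 = e1 + e2, e1·e2 = e2`. -/
noncomputable def C02 : V2 →ₗ[ℂ] V2 →ₗ[ℂ] V2 := bil ![![e1 + e2, e2], ![0, 0]]

/-- `C03 : e1·e1 = e2`. -/
noncomputable def C03 : V2 →ₗ[ℂ] V2 →ₗ[ℂ] V2 := bil ![![e2, 0], ![0, 0]]

/-- `C04 : e2·e1 = e1`. -/
noncomputable def C04 : V2 →ₗ[ℂ] V2 →ₗ[ℂ] V2 := bil ![![0, 0], ![e1, 0]]

/-- `C05^α : e1·e1 = e1, e1·e2 = α e2`. -/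
noncomputable def C05 (α : ℂ) : V2 →ₗ[ℂ] V2 →ₗ[ℂ] V2 := bil ![![e1, α • e2], ![0, 0]]

/-- `C06^α : e1·e1 = e1, e1·e2 = α e2, e2·e1 = e2`. -/
noncomputable def C06 (α : ℂ) : V2 →ₗ[ℂ] V2 →ₗ[ℂ] V2 := bil ![![e1, α • e2], ![e2, 0]]

/-- `C07 : e1·e1 = e1, e2·e2 = e2`. -/
noncomputable def C07 : V2 →ₗ[ℂ] V2 →ₗ[ℂ] V2 := bil ![![e1, 0], ![0, e2]]

/-- `C08 : e1·e1 = e1, e1·e2 = 2 e2, e2·e1 = (1/2) e1 + e2, e2·e2 = e2`. -/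
noncomputable def C08 : V2 →ₗ[ℂ] V2 →ₗ[ℂ] V2 :=
  bil ![![e1, (2 : ℂ) • e2], ![(1 / 2 : ℂ) • e1 + e2, e2]]

/-- The second multiplication of `C09^{α,β}`: `e1∗e1 = α e1, e1∗e2 = β e2, e2∗e1 = α e2`. -/
noncomputable def C09s (α β : ℂ) : V2 →ₗ[ℂ] V2 →ₗ[ℂ] V2 :=
  bil ![![α • e1, β • e2], ![α • e2, 0]]

/-- The second multiplication of `C10^{α,β}`: `e1∗e1 = α e1 + β e2, e2∗e1 = α e2`. -/
noncomputable def C10s (α β : ℂ) : V2 →ₗ[ℂ] V2 →ₗ[ℂ] V2 :=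
  bil ![![α • e1 + β • e2, 0], ![α • e2, 0]]

/-- The second multiplication of `C11^{α,β}`: `e1∗e1 = α e1, e1∗e2 = β e2`. -/
noncomputable def C11s (α β : ℂ) : V2 →ₗ[ℂ] V2 →ₗ[ℂ] V2 :=
  bil ![![α • e1, β • e2], ![0, 0]]

/-- The second multiplication of `C12^{α,β}`: `e1∗e1 = α e1 + β e2, e1∗e2 = α e2`. -/
noncomputable def C12s (α β : ℂ) : V2 →ₗ[ℂ] V2 →ₗ[ℂ] V2 :=
  bil ![![α • e1 + β • e2, α • e2], ![0, 0]]

/-- The second multiplication of `C13^α`: `e1∗e1 = α e1, e1∗e2 = e2, e2∗e1 = α e2`. -/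
noncomputable def C13s (α : ℂ) : V2 →ₗ[ℂ] V2 →ₗ[ℂ] V2 :=
  bil ![![α • e1, e2], ![α • e2, 0]]

/-- The second multiplication of `C14^α`: `e1∗e1 = e1 + α e2, e2∗e1 = e2`. -/
noncomputable def C14s (α : ℂ) : V2 →ₗ[ℂ] V2 →ₗ[ℂ] V2 :=
  bil ![![e1 + α • e2, 0], ![e2, 0]]

/-- The second multiplication of `C15^α`: `e1∗e1 = α e2`. -/
noncomputable def C15s (α : ℂ) : V2 →ₗ[ℂ] V2 →ₗ[ℂ] V2 :=
  bil ![![α • e2, 0], ![0, 0]]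

/-- The second multiplication of `C16^α`: `e1∗e1 = e1, e1∗e2 = α e2`. -/
noncomputable def C16s (α : ℂ) : V2 →ₗ[ℂ] V2 →ₗ[ℂ] V2 :=
  bil ![![e1, α • e2], ![0, 0]]

/-- The second multiplication of `C17^α`: `e1∗e1 = e1 + α e2, e1∗e2 = e2`. -/
noncomputable def C17s (α : ℂ) : V2 →ₗ[ℂ] V2 →ₗ[ℂ] V2 :=
  bil ![![e1 + α • e2, e2], ![0, 0]]

/-- The second multiplication of `C18^α`: `e1∗e1 = α e2, e1∗e2 = e1, e2∗e1 = e1, e2∗e2 = e2`. -/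
noncomputable def C18s (α : ℂ) : V2 →ₗ[ℂ] V2 →ₗ[ℂ] V2 :=
  bil ![![α • e2, e1], ![e1, e2]]

/-- The second multiplication of `C19^α`: `e1∗e1 = α e2, e2∗e1 = e1, e2∗e2 = 2 e2`. -/
noncomputable def C19s (α : ℂ) : V2 →ₗ[ℂ] V2 →ₗ[ℂ] V2 :=
  bil ![![α • e2, 0], ![e1, (2 : ℂ) • e2]]

/-- The second multiplication of `C20^{α,β}`: `e2∗e1 = α e1, e2∗e2 = e1 + β e2`. -/
noncomputable def C20s (α β : ℂ) : V2 →ₗ[ℂ] V2 →ₗ[ℂ] V2 :=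
  bil ![![0, 0], ![α • e1, e1 + β • e2]]

/-- The second multiplication of `C21^{α,β}`: `e2∗e1 = α e1, e2∗e2 = β e2`. -/
noncomputable def C21s (α β : ℂ) : V2 →ₗ[ℂ] V2 →ₗ[ℂ] V2 :=
  bil ![![0, 0], ![α • e1, β • e2]]

/-- The second multiplication of `C22^{α,β}`: `e1∗e2 = α e1, e2∗e1 = β e1, e2∗e2 = e1 + α e2`. -/
noncomputable def C22s (α β : ℂ) : V2 →ₗ[ℂ] V2 →ₗ[ℂ] V2 :=
  bil ![![0, α • e1], ![β • e1, e1 + α • e2]]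

/-- The second multiplication of `C23^{α,β}`: `e1∗e2 = α e1, e2∗e1 = β e1, e2∗e2 = α e2`. -/
noncomputable def C23s (α β : ℂ) : V2 →ₗ[ℂ] V2 →ₗ[ℂ] V2 :=
  bil ![![0, α • e1], ![β • e1, α • e2]]

/-- The second multiplication of `C24^{α,β,γ}`: `e1∗e1 = β e1 + e2, e1∗e2 = γ e2`. -/
noncomputable def C24s (β γ : ℂ) : V2 →ₗ[ℂ] V2 →ₗ[ℂ] V2 :=
  bil ![![β • e1 + e2, γ • e2], ![0, 0]]

/-- The second multiplication of `C25^{α,β,γ}`: `e1∗e1 = β e1, e1∗e2 = γ e2`. -/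
noncomputable def C25s (β γ : ℂ) : V2 →ₗ[ℂ] V2 →ₗ[ℂ] V2 :=
  bil ![![β • e1, γ • e2], ![0, 0]]

/-- The second multiplication of `C29^α`: `e1∗e1 = α e1, e2∗e2 = e2`. -/
noncomputable def C29s (α : ℂ) : V2 →ₗ[ℂ] V2 →ₗ[ℂ] V2 :=
  bil ![![α • e1, 0], ![0, e2]]

/-- The second multiplication of `C30^{α,β}`:
`e1∗e1 = α e1 + β e2, e1∗e2 = e1, e2∗e1 = e1, e2∗e2 = e2`. -/
noncomputable def C30s (α β : ℂ) : V2 →ₗ[ℂ] V2 →ₗ[ℂ] V2 :=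
  bil ![![α • e1 + β • e2, e1], ![e1, e2]]

/-- The second multiplication of `C31^{α,β,γ}`:
`e1∗e1 = β e1 + e2, e1∗e2 = γ e2, e2∗e1 = β e2`. -/
noncomputable def C31s (β γ : ℂ) : V2 →ₗ[ℂ] V2 →ₗ[ℂ] V2 :=
  bil ![![β • e1 + e2, γ • e2], ![β • e2, 0]]

/-- The second multiplication of `C32^{α,β,γ}`:
`e1∗e1 = β e1, e1∗e2 = γ e2, e2∗e1 = β e2`. -/
noncomputable def C32s (β γ : ℂ) : V2 →ₗ[ℂ] V2 →ₗ[ℂ] V2 :=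
  bil ![![β • e1, γ • e2], ![β • e2, 0]]

/-- The second multiplication of `C34^{α,β}`:
`e1∗e1 = α e1, e1∗e2 = α e2, e2∗e1 = α e2, e2∗e2 = e1 + β e2`. -/
noncomputable def C34s (α β : ℂ) : V2 →ₗ[ℂ] V2 →ₗ[ℂ] V2 :=
  bil ![![α • e1, α • e2], ![α • e2, e1 + β • e2]]

/-- The second multiplication of `C35^α`:
`e1∗e1 = α e1, e1∗e2 = α e2, e2∗e1 = α e2, e2∗e2 = e2`. -/
noncomputable def C35s (α : ℂ) : V2 →ₗ[ℂ] V2 →ₗ[ℂ] V2 :=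
  bil ![![α • e1, α • e2], ![α • e2, e2]]

/-- The second multiplication of `C38^{α,β,γ}`:
`e1∗e1 = (γ+β−α) e1 − β e2, e1∗e2 = α e1 + β e2, e2∗e1 = α e1 + β e2, e2∗e2 = −α e1 + γ e2`. -/
noncomputable def C38s (α β γ : ℂ) : V2 →ₗ[ℂ] V2 →ₗ[ℂ] V2 :=
  bil ![![(γ + β - α) • e1 - β • e2, α • e1 + β • e2],
        ![α • e1 + β • e2, (-α) • e1 + γ • e2]]

/-- The second multiplication of `C39^{α,β}`: `e1∗e1 = α e1, e2∗e2 = β e2`. -/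
noncomputable def C39s (α β : ℂ) : V2 →ₗ[ℂ] V2 →ₗ[ℂ] V2 :=
  bil ![![α • e1, 0], ![0, β • e2]]

/-- The second multiplication of `C40^{α,β,γ}`:
`e1∗e1 = α e1 + β e2, e1∗e2 = 2α e2, e2∗e1 = γ e1 + α e2, e2∗e2 = 2γ e2`. -/
noncomputable def C40s (α β γ : ℂ) : V2 →ₗ[ℂ] V2 →ₗ[ℂ] V2 :=
  bil ![![α • e1 + β • e2, (2 * α) • e2], ![γ • e1 + α • e2, (2 * γ) • e2]]

/-- The second multiplication of `C41^{α,β}`: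
`e1∗e1 = α e1, e1∗e2 = β e1 + 2α e2, e2∗e1 = (2β + α/2) e1 + α e2,
e2∗e2 = (β/2) e1 + (α+β) e2`. -/
noncomputable def C41s (α β : ℂ) : V2 →ₗ[ℂ] V2 →ₗ[ℂ] V2 :=
  bil ![![α • e1, β • e1 + (2 * α) • e2],
        ![(2 * β + α / 2) • e1 + α • e2, (β / 2) • e1 + (α + β) • e2]]

theorem bil_apply (f : Fin 2 → Fin 2 → V2) (x y : V2) :
    bil f x y = ∑ i : Fin 2, ∑ j : Fin 2, (x i * y j) • f i j := rfl

/-- Every bilinear multiplication on `ℂ²` is given by its multiplication table. -/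
theorem eq_bil_table (ν : V2 →ₗ[ℂ] V2 →ₗ[ℂ] V2) :
    ν = bil ![![ν e1 e1, ν e1 e2], ![ν e2 e1, ν e2 e2]] := by
  have decomp : ∀ x : V2, x = x 0 • e1 + x 1 • e2 := fun x => by
    ext i
    fin_cases i <;> simp [e1, e2]
  refine LinearMap.ext₂ fun x y => ?_
  rw [bil_apply]
  conv_lhs => rw [decomp x, decomp y]
  simp only [map_add, map_smul, LinearMap.add_apply, LinearMap.smul_apply, Fin.sum_univ_two,
    Matrix.cons_val_zero, Matrix.cons_val_one, smul_add, mul_smul]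
  rw [smul_comm (y 0) (x 1), smul_comm (y 1) (x 0), smul_comm (y 0) (x 0), smul_comm (y 1) (x 1)]
  abel

theorem CompatIso.refl (μ ν : V2 →ₗ[ℂ] V2 →ₗ[ℂ] V2) : CompatIso μ ν μ ν :=
  ⟨LinearEquiv.refl ℂ V2, fun _ _ => rfl, fun _ _ => rfl⟩

/-- The multiplication table of a multiplication compatible with `C07`: it is commutative and
depends on four parameters subject to the two associativity relations. -/
theorem exists_table_of_isCompatPreLie_C07 (ν : V2 →ₗ[ℂ] V2 →ₗ[ℂ] V2)
    (h : IsCompatPreLie C07 ν) :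
    ∃ a b c d : ℂ,
      ν = bil ![![a • e1 - c • e2, b • e1 + c • e2], ![b • e1 + c • e2, (-b) • e1 + d • e2]] ∧
      b * (d + c - b - a) = 0 ∧ c * (d + c - b - a) = 0 := by
  obtain ⟨-, hν, hsum⟩ := h
  have hν₁ := hν e1 e2 e1
  have hν₂ := hν e1 e2 e2
  have hsum₁ := hsum e1 e2 e1
  have hsum₂ := hsum e1 e2 e2
  rw [eq_bil_table ν] at hν₁ hν₂ hsum₁ hsum₂ ⊢
  generalize ν e1 e1 = p at *
  generalize ν e1 e2 = q at *
  generalize ν e2 e1 = r at *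
  generalize ν e2 e2 = s at *
  simp [funext_iff, Fin.forall_fin_two, C07, bil_apply, Fin.sum_univ_two, e1, e2, Matrix.vecHead,
    Matrix.vecTail] at hν₁ hν₂ hsum₁ hsum₂
  have hr₀ : r 0 = q 0 := by grind
  have hr₁ : r 1 = - p 1 := by grind
  have hq₁ : q 1 = - p 1 := by grind
  have hs₀ : s 0 = - q 0 := by grind
  refine ⟨p 0, q 0, q 1, s 1, ?_, by grind, by grind⟩
  congr 1
  ext i j k
  fin_cases i <;> fin_cases j <;> fin_cases k <;> simp [e1, e2, *]

/-- Every compatible pre-Lie algebra whose first multiplication is `C07`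
(`e1·e1 = e1, e2·e2 = e2`) is isomorphic to some `C38^{α,β,γ}` or some
`C39^{α,β}` (`β ≠ α`). -/
theorem compatible_preLie_on_C07 (ν : V2 →ₗ[ℂ] V2 →ₗ[ℂ] V2)
    (h : IsCompatPreLie C07 ν) :
    (∃ α β γ : ℂ, CompatIso C07 ν C07 (C38s α β γ)) ∨
      (∃ α β : ℂ, β ≠ α ∧ CompatIso C07 ν C07 (C39s α β)) := by
  obtain ⟨a, b, c, d, rfl, hb, hc⟩ := exists_table_of_isCompatPreLie_C07 ν h
  by_cases had : d + c - b - a = 0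
  · obtain rfl : a = d + c - b := by linear_combination -had
    exact Or.inl ⟨b, c, d, CompatIso.refl _ _⟩
  · obtain rfl := (mul_eq_zero.mp hb).resolve_right had
    obtain rfl := (mul_eq_zero.mp hc).resolve_right had
    refine Or.inr ⟨a, d, fun hda => had (by simp [hda]), ?_⟩
    simpa [C39s] using CompatIso.refl C07 (C39s a d)
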